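/- arXiv:2602.10512 — 3 statements merged into one kernel-verified Lean document; each statement's English description precedes it below -/
import Mathlib

section
/- (Covering number of a Lipschitz function ball on a totally bounded space.) Let (𝒮, d) be a compact metric space, B > 0, L > 0, and ε ∈ (0, B]. Let M := N_𝒮(ε/(4L)) be the minimal cardinality of an (ε/(4L))-net of 𝒮. Then there exists a finite set 𝒱 of functions from 𝒮 to ℝ with |𝒱| ≤ (2B/ε)^M such that for every function f : 𝒮 → [0, B] that is Lipschitz with constant L, there exists v ∈ 𝒱 with sup_{s ∈ 𝒮} |f(s) − v(s)| ≤ ε. In particular, the ε-covering number of the class of L-Lipschitz [0,B]-valued functions in the supremum norm has logarithm at most N_𝒮(ε/(4L)) · log(2B/ε). -/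
/-- **Covering number of a Lipschitz function ball on a totally bounded space.**
Let `(S, d)` be a compact metric space, `B > 0`, `L > 0`, `ε ∈ (0, B]`, and let `M`
be the minimal cardinality of an `(ε/(4L))`-net of `S`. Then there is a finite set `𝒱`
of functions `S → ℝ` with `|𝒱| ≤ (2B/ε)^M` such that every `L`-Lipschitz function
`f : S → [0, B]` is within supremum distance `ε` of some member of `𝒱`.  (Hence the
`ε`-covering number of this class in the supremum norm has logarithm at most
`M · log(2B/ε)`.) -/
theorem stmt8 {S : Type*} [MetricSpace S] [CompactSpace S]
    (B L ε : ℝ) (hB : 0 < B) (hL : 0 < L) (hε : 0 < ε) (hεB : ε ≤ B) (M : ℕ)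
    (hM : IsLeast {n : ℕ | ∃ net : Finset S, net.card = n ∧
      ∀ s : S, ∃ t ∈ net, dist s t ≤ ε / (4 * L)} M) :
    ∃ 𝒱 : Finset (S → ℝ), (𝒱.card : ℝ) ≤ (2 * B / ε) ^ M ∧
      ∀ f : S → ℝ, (∀ s, f s ∈ Set.Icc 0 B) → (∀ s s', |f s - f s'| ≤ L * dist s s') →
        ∃ v ∈ 𝒱, ∀ s, |f s - v s| ≤ ε := by
  classical
  obtain ⟨⟨net, hcard, hnet⟩, -⟩ := hM
  choose π hπ hdist using hnet
  let K : ℕ := ⌊B / ε⌋₊ + 1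
  let F : (net → Fin K) → S → ℝ := fun c s => ((c ⟨π s, hπ s⟩ : ℕ) + 1 / 2 : ℝ) * ε
  refine ⟨Finset.univ.image F, ?_, fun f hf hLip => ?_⟩
  · have hK : (K : ℝ) ≤ 2 * B / ε := by
      have h1 : (⌊B / ε⌋₊ : ℝ) ≤ B / ε := Nat.floor_le (by positivity)
      have h2 : 1 ≤ B / ε := (one_le_div hε).2 hεB
      have h3 : 2 * B / ε = B / ε + B / ε := by ring
      simp only [K]
      push_cast
      linarith
    have hle : (Finset.univ.image F).card ≤ K ^ M := by
      refine Finset.card_image_le.trans_eq ?_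
      simp [hcard]
    calc ((Finset.univ.image F).card : ℝ) ≤ (K : ℝ) ^ M := by exact_mod_cast hle
      _ ≤ (2 * B / ε) ^ M := by gcongr
  · have hlt (t : S) : ⌊f t / ε⌋₊ < K :=
      Nat.lt_succ_of_le (Nat.floor_le_floor (div_le_div_of_nonneg_right (hf t).2 hε.le))
    refine ⟨F fun t => ⟨⌊f t / ε⌋₊, hlt t⟩, Finset.mem_image_of_mem _ (Finset.mem_univ _),
      fun s => ?_⟩
    have hs : |f s - f (π s)| ≤ ε / 4 := by
      refine (hLip s (π s)).trans ((mul_le_mul_of_nonneg_left (hdist s) hL.le).trans_eq ?_)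
      field_simp
    have h1 : (⌊f (π s) / ε⌋₊ : ℝ) * ε ≤ f (π s) :=
      (le_div_iff₀ hε).1 (Nat.floor_le (div_nonneg (hf _).1 hε.le))
    have h2 : f (π s) < (⌊f (π s) / ε⌋₊ + 1 : ℝ) * ε :=
      (div_lt_iff₀ hε).1 (Nat.lt_floor_add_one _)
    rw [abs_le] at hs ⊢
    simp only [F]
    constructor <;> linarith
end

section
/- (Misranking implies a large ℓ∞ deviation.) Let A be a finite nonempty set, let q and π be probability vectors on A, and let 1 ≤ k ≤ |A|. If S_π is a top-k set for π, S_q is a top-k set for q, and S_π ≠ S_q, then max_{a ∈ A} |π(a) − q(a)| ≥ Δ_k(q)/2. -/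
/-- `S` is a top-`k` set for the probability vector `p` on the finite type `A`:
it has `k` elements and `p` is at least as large on `S` as on its complement. -/
def IsTopK {A : Type*} [Fintype A] (p : A → ℝ) (k : ℕ) (S : Finset A) : Prop :=
  S.card = k ∧ ∀ a ∈ S, ∀ b ∉ S, p b ≤ p a

/-- The `i`-th largest value (1-indexed) among the values of `p : A → ℝ` on the finite
type `A` (counted with multiplicity), with the convention that it is `0` when `i` is
out of range (in particular `p_(|A|+1) = 0`). -/
noncomputable def orderStat {A : Type*} [Fintype A] (p : A → ℝ) (i : ℕ) : ℝ :=
  let l := ((Finset.univ : Finset A).val.map p).sort (· ≤ ·)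
  if 1 ≤ i ∧ i ≤ l.length then l.getD (l.length - i) 0 else 0

/-- The top-`k` margin (gap) `Δ_k(p) := p_(k) − p_(k+1)`, with the convention
`p_(k+1) := 0` when `|A| = k`. -/
noncomputable def gapK {A : Type*} [Fintype A] (p : A → ℝ) (k : ℕ) : ℝ :=
  orderStat p k - orderStat p (k + 1)

open Classical in
/-- The number of entries of the sorted list of values of `p` satisfying `P` equals the number
of points whose value satisfies `P`. -/
theorem countP_sort_map {A : Type*} [Fintype A] (p : A → ℝ) (P : ℝ → Prop) :
    (((Finset.univ : Finset A).val.map p).sort (· ≤ ·)).countP (fun y => decide (P y)) =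
      (Finset.univ.filter fun a => P (p a)).card := by
  rw [← Multiset.coe_countP, Multiset.sort_eq, Multiset.countP_map]
  rfl

/-- In range, `orderStat p i` is an entry of the sorted list of values. -/
theorem orderStat_eq_getElem {A : Type*} [Fintype A] (p : A → ℝ) {i : ℕ} (hi : 1 ≤ i)
    (hiA : i ≤ Fintype.card A) :
    ∃ h : Fintype.card A - i < (((Finset.univ : Finset A).val.map p).sort (· ≤ ·)).length,
      orderStat p i =
        (((Finset.univ : Finset A).val.map p).sort (· ≤ ·))[Fintype.card A - i] := by
  have hl : (((Finset.univ : Finset A).val.map p).sort (· ≤ ·)).length = Fintype.card A := by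
    simp
  refine ⟨by omega, ?_⟩
  simp only [orderStat, hl, hi, hiA, and_self, if_true]
  exact List.getD_eq_getElem _ _ _

/-- If fewer than `i` points have value above `x`, the `i`-th largest value is at most `x`. -/
theorem orderStat_le_of_card_lt {A : Type*} [Fintype A] (p : A → ℝ) {i : ℕ} {x : ℝ}
    (hiA : i ≤ Fintype.card A) (h : (Finset.univ.filter fun a => x < p a).card < i) :
    orderStat p i ≤ x := by
  classical
  obtain ⟨hlt, heq⟩ := orderStat_eq_getElem p (by omega) hiA
  rw [heq]
  by_contra! hx
  have hcount := countP_sort_map p (fun y => x < y)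
  have hsorted := Multiset.pairwise_sort ((Finset.univ : Finset A).val.map p) (· ≤ ·)
  have hl : (((Finset.univ : Finset A).val.map p).sort (· ≤ ·)).length = Fintype.card A := by
    simp
  generalize ((Finset.univ : Finset A).val.map p).sort (· ≤ ·) = l at *
  have hdrop : (l.drop (Fintype.card A - i)).countP (fun y => decide (x < y)) =
      (l.drop (Fintype.card A - i)).length := by
    rw [List.countP_eq_length]
    intro y hy
    obtain ⟨j, hj, rfl⟩ := List.mem_iff_getElem.1 hy
    rw [List.getElem_drop, decide_eq_true_eq]
    exact hx.trans_le (hsorted.sortedLE.getElem_le_getElem_of_le (by omega))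
  have hle := (List.drop_sublist (Fintype.card A - i) l).countP_le
    (p := fun y => decide (x < y))
  rw [hdrop, List.length_drop] at hle
  have : (Finset.univ.filter fun a => x < p a).card = l.countP (fun y => decide (x < y)) := by
    rw [hcount]
  omega

/-- If at most `|A| - i` points have value below `x`, the `i`-th largest value is at
least `x`. -/
theorem le_orderStat_of_card_le {A : Type*} [Fintype A] (p : A → ℝ) {i : ℕ} {x : ℝ}
    (hi : 1 ≤ i) (hiA : i ≤ Fintype.card A)
    (h : (Finset.univ.filter fun a => p a < x).card ≤ Fintype.card A - i) :
    x ≤ orderStat p i := by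
  classical
  obtain ⟨hlt, heq⟩ := orderStat_eq_getElem p hi hiA
  rw [heq]
  by_contra! hx
  have hcount := countP_sort_map p (fun y => y < x)
  have hsorted := Multiset.pairwise_sort ((Finset.univ : Finset A).val.map p) (· ≤ ·)
  generalize ((Finset.univ : Finset A).val.map p).sort (· ≤ ·) = l at *
  have htake : (l.take (Fintype.card A - i + 1)).countP (fun y => decide (y < x)) =
      (l.take (Fintype.card A - i + 1)).length := by
    rw [List.countP_eq_length]
    intro y hy
    obtain ⟨j, hj, rfl⟩ := List.mem_iff_getElem.1 hy
    rw [List.length_take] at hj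
    rw [List.getElem_take, decide_eq_true_eq]
    exact (hsorted.sortedLE.getElem_le_getElem_of_le (by omega)).trans_lt hx
  have hle := (List.take_sublist (Fintype.card A - i + 1) l).countP_le
    (p := fun y => decide (y < x))
  rw [htake, List.length_take] at hle
  have : (Finset.univ.filter fun a => p a < x).card = l.countP (fun y => decide (y < x)) := by
    rw [hcount]
  omega

/-- Every member of a top-`k` set has value at least the `k`-th largest value. -/
theorem IsTopK.orderStat_le {A : Type*} [Fintype A] {p : A → ℝ} {k : ℕ} {S : Finset A}
    (hS : IsTopK p k S) {a : A} (ha : a ∈ S) : orderStat p k ≤ p a := by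
  refine orderStat_le_of_card_lt p (hS.1 ▸ S.card_le_univ) ?_
  rw [← hS.1]
  refine Finset.card_lt_card ((Finset.ssubset_iff_of_subset fun c hc => ?_).2 ⟨a, ha, by simp⟩)
  by_contra hcS
  exact (hS.2 a ha c hcS).not_gt (Finset.mem_filter.1 hc).2

/-- Every point outside a top-`k` set has value at most the `(k+1)`-th largest value. -/
theorem IsTopK.le_orderStat_succ {A : Type*} [Fintype A] {p : A → ℝ} {k : ℕ} {S : Finset A}
    (hS : IsTopK p k S) {b : A} (hb : b ∉ S) : p b ≤ orderStat p (k + 1) := by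
  classical
  have hlt : (Finset.univ.filter fun c => p c < p b).card < Sᶜ.card := by
    refine Finset.card_lt_card ((Finset.ssubset_iff_of_subset fun c hc => ?_).2
      ⟨b, by simpa using hb, by simp⟩)
    rw [Finset.mem_compl]
    exact fun hcS => (hS.2 c hcS b hb).not_gt (Finset.mem_filter.1 hc).2
  rw [Finset.card_compl, hS.1] at hlt
  exact le_orderStat_of_card_le p (by omega) (by omega) (by omega)

/-- **Misranking implies a large ℓ∞ deviation.** If `Sπ` is a top-`k` set for `π`,
`Sq` is a top-`k` set for `q`, and `Sπ ≠ Sq`, then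
`max_{a ∈ A} |π a − q a| ≥ Δ_k(q)/2`. -/
theorem stmt10 {A : Type*} [Fintype A] [Nonempty A] [DecidableEq A]
    (q π : A → ℝ) (hq0 : ∀ a, 0 ≤ q a) (hq1 : ∑ a, q a = 1)
    (hπ0 : ∀ a, 0 ≤ π a) (hπ1 : ∑ a, π a = 1)
    (k : ℕ) (hk1 : 1 ≤ k) (hk2 : k ≤ Fintype.card A)
    (Sπ Sq : Finset A) (hSπ : IsTopK π k Sπ) (hSq : IsTopK q k Sq) (hne : Sπ ≠ Sq) :
    gapK q k / 2 ≤ Finset.univ.sup' Finset.univ_nonempty (fun a => |π a - q a|) := by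
  have hcard : Sπ.card = Sq.card := hSπ.1.trans hSq.1.symm
  obtain ⟨a, haq, haπ⟩ := Finset.not_subset.1 fun h : Sq ⊆ Sπ =>
    hne (Finset.eq_of_subset_of_card_le h hcard.le).symm
  obtain ⟨b, hbπ, hbq⟩ := Finset.not_subset.1 fun h : Sπ ⊆ Sq =>
    hne (Finset.eq_of_subset_of_card_le h hcard.ge)
  have h1 := hSq.orderStat_le haq
  have h2 := hSq.le_orderStat_succ hbq
  have h3 := hSπ.2 b hbπ a haπ
  have h4 := Finset.le_sup' (fun a => |π a - q a|) (Finset.mem_univ a)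
  have h5 := Finset.le_sup' (fun a => |π a - q a|) (Finset.mem_univ b)
  have h6 := neg_abs_le (π a - q a)
  have h7 := le_abs_self (π b - q b)
  unfold gapK
  linarith
end

section
/- (Margin-controlled misranking probability.) Let A be a finite nonempty set, 1 ≤ k ≤ |A|, and let S be a random state on a probability space together with measurable assignments s ↦ q(·|s) and s ↦ π(·|s) of probability vectors on A (π strictly positive) and measurable choices of top-k sets S_q(s) for q(·|s) and S_π(s) for π(·|s). Assume the Tsybakov-type margin condition: there are C₀ > 0 and β > 0 with P(Δ_k(q(·|S)) ≤ u) ≤ C₀ u^β for all u > 0, and let KL̄ := E[KL(q(·|S)‖π(·|S))]. Then for every u > 0, P(S_π(S) ≠ S_q(S)) ≤ C₀ u^β + 8·KL̄/u², and consequently there exists a constant C depending only on β and C₀ such that P(S_π(S) ≠ S_q(S)) ≤ C · KL̄^{β/(β+2)}. -/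
open MeasureTheory

/-- `KL(q‖π) := Σ_a q(a) log(q(a)/π(a))` for probability vectors on a finite type. -/
noncomputable def KLfin {A : Type*} [Fintype A] (q π : A → ℝ) : ℝ :=
  ∑ a, q a * Real.log (q a / π a)

theorem List.SortedLE.length_sub_le_countP_lt {l : List ℝ} (hl : l.SortedLE) {i : ℕ}
    (hi : i < l.length) {t : ℝ} (ht : t < l[i]) :
    l.length - i ≤ l.countP (fun x => decide (t < x)) := by
  rw [← List.length_drop]
  calc (l.drop i).length = (l.drop i).countP (fun x => decide (t < x)) := by
        symm
        rw [List.countP_eq_length]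
        intro x hx
        obtain ⟨j, hj, rfl⟩ := List.mem_iff_getElem.1 hx
        rw [List.getElem_drop]
        have hj' : i + j < l.length := by rw [List.length_drop] at hj; omega
        have : l[i] ≤ l[i + j] := hl.getElem_le_getElem_of_le (by omega)
        simpa using ht.trans_le this
    _ ≤ _ := (List.drop_sublist i l).countP_le

theorem List.SortedLE.succ_le_countP_gt {l : List ℝ} (hl : l.SortedLE) {i : ℕ}
    (hi : i < l.length) {t : ℝ} (ht : l[i] < t) :
    i + 1 ≤ l.countP (fun x => decide (x < t)) := by
  have hlen : (l.take (i + 1)).length = i + 1 := by rw [List.length_take]; omega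
  calc i + 1 = (l.take (i + 1)).countP (fun x => decide (x < t)) := by
        conv_lhs => rw [← hlen]
        symm
        rw [List.countP_eq_length]
        intro x hx
        obtain ⟨j, hj, rfl⟩ := List.mem_iff_getElem.1 hx
        rw [List.getElem_take]
        have hj' : j < i + 1 := by rwa [hlen] at hj
        have : l[j] ≤ l[i] := hl.getElem_le_getElem_of_le (by omega)
        simpa using this.trans_lt ht
    _ ≤ _ := (List.take_sublist (i + 1) l).countP_le

theorem countP_sort_map_univ {A : Type*} [Fintype A] (p : A → ℝ) (P : ℝ → Prop)
    [DecidablePred P] :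
    (((Finset.univ : Finset A).val.map p).sort (· ≤ ·)).countP (fun x => decide (P x))
      = (Finset.univ.filter fun a => P (p a)).card := by
  rw [← Multiset.coe_countP, Multiset.sort_eq, Multiset.countP_map]
  rfl

namespace IsTopK

variable {A : Type*} [Fintype A] {p : A → ℝ} {k : ℕ} {S : Finset A}

theorem orderStat_le_s12 (h : IsTopK p k S) {a : A} (ha : a ∈ S) : orderStat p k ≤ p a := by
  classical
  set l := ((Finset.univ : Finset A).val.map p).sort (· ≤ ·) with hl
  have hlen : l.length = Fintype.card A := by simp [hl]
  have hk1 : 1 ≤ k := h.1 ▸ Finset.card_pos.2 ⟨a, ha⟩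
  have hk2 : k ≤ l.length := hlen ▸ h.1 ▸ Finset.card_le_univ S
  have hi : l.length - k < l.length := by omega
  have heq : orderStat p k = l[l.length - k] := by
    simp only [orderStat, ← hl]
    rw [if_pos ⟨hk1, hk2⟩, List.getD_eq_getElem _ _ hi]
  rw [heq]
  by_contra! hlt
  have h1 := List.SortedLE.length_sub_le_countP_lt (Multiset.pairwise_sort _ _).sortedLE hi hlt
  rw [hl, countP_sort_map_univ, ← hl] at h1
  have h2 : (Finset.univ.filter fun x => p a < p x) ⊆ S.erase a := by
    intro x hx
    simp only [Finset.mem_filter, Finset.mem_univ, true_and] at hx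
    refine Finset.mem_erase.2 ⟨by rintro rfl; exact lt_irrefl _ hx, ?_⟩
    by_contra hxS
    exact absurd (h.2 a ha x hxS) (not_le.2 hx)
  have h3 := Finset.card_le_card h2
  rw [Finset.card_erase_of_mem ha, h.1] at h3
  omega

theorem le_orderStat_succ_s12 (h : IsTopK p k S) {b : A} (hb : b ∉ S) :
    p b ≤ orderStat p (k + 1) := by
  classical
  set l := ((Finset.univ : Finset A).val.map p).sort (· ≤ ·) with hl
  have hlen : l.length = Fintype.card A := by simp [hl]
  have hk2 : k + 1 ≤ l.length := by
    rw [hlen, ← h.1]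
    exact Finset.card_lt_univ_of_notMem hb
  have hi : l.length - (k + 1) < l.length := by omega
  have heq : orderStat p (k + 1) = l[l.length - (k + 1)] := by
    simp only [orderStat, ← hl]
    rw [if_pos ⟨by omega, hk2⟩, List.getD_eq_getElem _ _ hi]
  rw [heq]
  by_contra! hlt
  have h1 := List.SortedLE.succ_le_countP_gt (Multiset.pairwise_sort _ _).sortedLE hi hlt
  rw [hl, countP_sort_map_univ p (fun x => x < p b), ← hl] at h1
  have h2 : (Finset.univ.filter fun x => p x < p b) ⊆ Sᶜ.erase b := by
    intro x hx
    simp only [Finset.mem_filter, Finset.mem_univ, true_and] at hx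
    refine Finset.mem_erase.2 ⟨by rintro rfl; exact lt_irrefl _ hx, ?_⟩
    rw [Finset.mem_compl]
    intro hxS
    exact absurd (h.2 x hxS b hb) (not_le.2 hx)
  have h3 := Finset.card_le_card h2
  rw [Finset.card_erase_of_mem (Finset.mem_compl.2 hb), Finset.card_compl, h.1] at h3
  omega

theorem gapK_le_sub (h : IsTopK p k S) {a b : A} (ha : a ∈ S) (hb : b ∉ S) :
    gapK p k ≤ p a - p b :=
  sub_le_sub (h.orderStat_le_s12 ha) (h.le_orderStat_succ_s12 hb)

end IsTopK

theorem two_mul_sub_sqrt_le_mul_log_div {x y : ℝ} (hx : 0 ≤ x) (hy : 0 < y) :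
    2 * x - 2 * (√x * √y) ≤ x * Real.log (x / y) := by
  rcases hx.eq_or_lt with rfl | hx
  · simp
  have hsx := Real.sqrt_pos.2 hx
  have hsy := Real.sqrt_pos.2 hy
  have hlog := Real.log_le_sub_one_of_pos (div_pos hsy hsx)
  have hxy : Real.log (x / y) = -2 * Real.log (√y / √x) := by
    rw [Real.log_div hx.ne' hy.ne', Real.log_div hsy.ne' hsx.ne', Real.log_sqrt hx.le,
      Real.log_sqrt hy.le]
    ring
  have hmul : x * (√y / √x) = √x * √y := by
    rw [mul_div_assoc', div_eq_iff hsx.ne']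
    nlinarith [Real.mul_self_sqrt hx.le]
  rw [hxy]
  nlinarith [mul_le_mul_of_nonneg_left hlog hx.le]

theorem hellinger_sq_le_KLfin {A : Type*} [Fintype A] {q π : A → ℝ}
    (hq : ∀ a, 0 ≤ q a) (hq1 : ∑ a, q a = 1) (hπ : ∀ a, 0 < π a) (hπ1 : ∑ a, π a = 1) :
    ∑ a, (√(q a) - √(π a)) ^ 2 ≤ KLfin q π := by
  have hle : ∑ a, (2 * q a - 2 * (√(q a) * √(π a))) ≤ KLfin q π :=
    Finset.sum_le_sum fun a _ => two_mul_sub_sqrt_le_mul_log_div (hq a) (hπ a)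
  refine le_trans (le_of_eq ?_) hle
  have hterm : ∀ a, (√(q a) - √(π a)) ^ 2
      = (2 * q a - 2 * (√(q a) * √(π a))) + (π a - q a) := fun a => by
    nlinarith [Real.mul_self_sqrt (hq a), Real.mul_self_sqrt (hπ a).le]
  simp only [hterm, Finset.sum_add_distrib, Finset.sum_sub_distrib, hq1, hπ1]
  ring

theorem KLfin_nonneg {A : Type*} [Fintype A] {q π : A → ℝ}
    (hq : ∀ a, 0 ≤ q a) (hq1 : ∑ a, q a = 1) (hπ : ∀ a, 0 < π a) (hπ1 : ∑ a, π a = 1) :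
    0 ≤ KLfin q π :=
  (Finset.sum_nonneg fun _ _ => sq_nonneg _).trans (hellinger_sq_le_KLfin hq hq1 hπ hπ1)

theorem sq_le_four_mul_KLfin {A : Type*} [Fintype A] {q π : A → ℝ}
    (hq : ∀ a, 0 ≤ q a) (hq1 : ∑ a, q a = 1) (hπ : ∀ a, 0 < π a) (hπ1 : ∑ a, π a = 1)
    {a b : A} (hab : a ≠ b) (hπab : π a ≤ π b) {u : ℝ} (hu : 0 ≤ u) (hgap : u ≤ q a - q b) :
    u ^ 2 ≤ 4 * KLfin q π := by
  classical
  have hpair : ∀ f : A → ℝ, (∀ x, 0 ≤ f x) → f a + f b ≤ ∑ x, f x := fun f hf => by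
    rw [← Finset.sum_pair hab]
    exact Finset.sum_le_sum_of_subset_of_nonneg (Finset.subset_univ _) fun x _ _ => hf x
  have hH := (hpair (fun x => (√(q x) - √(π x)) ^ 2) fun _ => sq_nonneg _).trans
    (hellinger_sq_le_KLfin hq hq1 hπ hπ1)
  have hqab := hpair q hq
  have hπs := hpair π fun x => (hπ x).le
  rw [hq1] at hqab
  rw [hπ1] at hπs
  have e1 := Real.sq_sqrt (hq a)
  have e2 := Real.sq_sqrt (hq b)
  have e3 := Real.sq_sqrt (hπ a).le
  have e4 := Real.sq_sqrt (hπ b).le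
  set x := √(q a)
  set y := √(q b)
  set z := √(π a)
  set w := √(π b)
  have h1 : u ≤ (x - z) * (x + z) + (w - y) * (w + y) := by nlinarith
  have h2 : (x + z) ^ 2 + (w + y) ^ 2 ≤ 4 := by
    nlinarith [sq_nonneg (x - z), sq_nonneg (w - y)]
  calc u ^ 2 ≤ ((x - z) * (x + z) + (w - y) * (w + y)) ^ 2 := by gcongr
    _ ≤ ((x - z) ^ 2 + (w - y) ^ 2) * ((x + z) ^ 2 + (w + y) ^ 2) := by
      nlinarith [sq_nonneg ((x - z) * (w + y) - (w - y) * (x + z))]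
    _ ≤ ((x - z) ^ 2 + (w - y) ^ 2) * 4 := by gcongr
    _ ≤ 4 * KLfin q π := by nlinarith

theorem IsTopK.sq_le_four_mul_KLfin_of_ne {A : Type*} [Fintype A] {q π : A → ℝ} {k : ℕ}
    {Sq Sπ : Finset A}
    (hq : ∀ a, 0 ≤ q a) (hq1 : ∑ a, q a = 1) (hπ : ∀ a, 0 < π a) (hπ1 : ∑ a, π a = 1)
    (hSq : IsTopK q k Sq) (hSπ : IsTopK π k Sπ) (hne : Sπ ≠ Sq)
    {u : ℝ} (hu : 0 ≤ u) (hgap : u ≤ gapK q k) : u ^ 2 ≤ 4 * KLfin q π := by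
  obtain ⟨a, haq, haπ⟩ : ∃ a ∈ Sq, a ∉ Sπ := by
    by_contra! hsub
    exact hne (Finset.eq_of_subset_of_card_le hsub (by rw [hSπ.1, hSq.1])).symm
  obtain ⟨b, hbπ, hbq⟩ : ∃ b ∈ Sπ, b ∉ Sq := by
    by_contra! hsub
    exact hne (Finset.eq_of_subset_of_card_le hsub (by rw [hSπ.1, hSq.1]))
  exact sq_le_four_mul_KLfin hq hq1 hπ hπ1 (by rintro rfl; exact hbq haq)
    (hSπ.2 b hbπ a haπ) hu (hgap.trans (hSq.gapK_le_sub haq hbq))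

theorem le_ofReal_mul_rpow_of_forall_le {m : ENNReal} {β C₀ K : ℝ} (hβ : 0 < β) (hK : 0 ≤ K)
    (h : ∀ u : ℝ, 0 < u → m ≤ ENNReal.ofReal (C₀ * u ^ β + 8 * K / u ^ 2)) :
    m ≤ ENNReal.ofReal ((C₀ + 8) * K ^ (β / (β + 2))) := by
  rcases hK.eq_or_lt with rfl | hK
  · rw [Real.zero_rpow (by positivity)]
    have hlim : Filter.Tendsto (fun u : ℝ => ENNReal.ofReal (C₀ * u ^ β))
        (nhdsWithin 0 (Set.Ioi 0)) (nhds (ENNReal.ofReal (C₀ * 0 ^ β))) :=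
      (ENNReal.continuous_ofReal.comp
        ((Real.continuous_rpow_const hβ.le).const_mul C₀)).continuousWithinAt
    rw [Real.zero_rpow hβ.ne', mul_zero] at hlim
    rw [mul_zero]
    refine ge_of_tendsto hlim ?_
    filter_upwards [self_mem_nhdsWithin] with u hu
    simpa using h u hu
  · refine (h (K ^ (1 / (β + 2))) (by positivity)).trans_eq (congrArg _ ?_)
    have h1 : (K ^ (1 / (β + 2))) ^ β = K ^ (β / (β + 2)) := by
      rw [← Real.rpow_mul hK.le]
      congr 1
      ring
    have h2 : K / (K ^ (1 / (β + 2))) ^ 2 = K ^ (β / (β + 2)) := by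
      rw [← Real.rpow_natCast, ← Real.rpow_mul hK.le]
      conv_lhs => rw [← Real.rpow_one K, ← Real.rpow_mul hK.le, ← Real.rpow_sub hK]
      congr 1
      field_simp
      push_cast
      ring
    rw [h1, mul_div_assoc, h2]
    ring

/-- **Margin-controlled misranking probability.** Under a Tsybakov-type margin condition
`P(Δ_k(q(·|S)) ≤ u) ≤ C₀ u^β`, for measurable assignments of probability vectors
`q(·|S), π(·|S)` (with `π` strictly positive) and measurable top-`k` selections,
the misranking probability satisfies, for every `u > 0`,
`P(S_π(S) ≠ S_q(S)) ≤ C₀ u^β + 8·KL̄/u²` with `KL̄ = E[KL(q(·|S)‖π(·|S))]`, and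
consequently there is a constant `C` depending only on `β` and `C₀` with
`P(S_π(S) ≠ S_q(S)) ≤ C·KL̄^{β/(β+2)}`. -/
theorem stmt12 {A : Type*} [Fintype A] [Nonempty A] [DecidableEq A]
    (k : ℕ) (hk1 : 1 ≤ k) (hk2 : k ≤ Fintype.card A)
    (β C₀ : ℝ) (hβ : 0 < β) (hC₀ : 0 < C₀) :
    ∃ C : ℝ, 0 < C ∧
      ∀ (Ω : Type) (mΩ : MeasurableSpace Ω) (μ : Measure Ω), IsProbabilityMeasure μ →
      ∀ (q π : Ω → A → ℝ),
        (∀ ω, (∀ a, 0 ≤ q ω a) ∧ ∑ a, q ω a = 1) →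
        (∀ ω, (∀ a, 0 < π ω a) ∧ ∑ a, π ω a = 1) →
        (∀ a, Measurable fun ω => q ω a) →
        (∀ a, Measurable fun ω => π ω a) →
      ∀ (Sq Sπ : Ω → Finset A),
        (∀ ω, IsTopK (q ω) k (Sq ω)) →
        (∀ ω, IsTopK (π ω) k (Sπ ω)) →
        (∀ s : Finset A, MeasurableSet {ω | Sq ω = s}) →
        (∀ s : Finset A, MeasurableSet {ω | Sπ ω = s}) →
        (∀ u : ℝ, 0 < u → μ {ω | gapK (q ω) k ≤ u} ≤ ENNReal.ofReal (C₀ * u ^ β)) →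
        Integrable (fun ω => KLfin (q ω) (π ω)) μ →
        (∀ u : ℝ, 0 < u →
            μ {ω | Sπ ω ≠ Sq ω}
              ≤ ENNReal.ofReal (C₀ * u ^ β + 8 * (∫ ω, KLfin (q ω) (π ω) ∂μ) / u ^ 2)) ∧
          μ {ω | Sπ ω ≠ Sq ω}
            ≤ ENNReal.ofReal (C * (∫ ω, KLfin (q ω) (π ω) ∂μ) ^ (β / (β + 2))) := by
  refine ⟨C₀ + 8, by positivity, ?_⟩
  intro Ω mΩ μ hμ q π hq hπ _ _ Sq Sπ hSq hSπ _ _ hmargin hint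
  have hKL : ∀ ω, 0 ≤ KLfin (q ω) (π ω) := fun ω =>
    KLfin_nonneg (hq ω).1 (hq ω).2 (hπ ω).1 (hπ ω).2
  have hK : 0 ≤ ∫ ω, KLfin (q ω) (π ω) ∂μ := integral_nonneg hKL
  have hbound : ∀ u : ℝ, 0 < u → μ {ω | Sπ ω ≠ Sq ω}
      ≤ ENNReal.ofReal (C₀ * u ^ β + 8 * (∫ ω, KLfin (q ω) (π ω) ∂μ) / u ^ 2) := by
    intro u hu
    have hsub : {ω | Sπ ω ≠ Sq ω}
        ⊆ {ω | gapK (q ω) k ≤ u} ∪ {ω | u ^ 2 / 8 ≤ KLfin (q ω) (π ω)} := by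
      intro ω hω
      rcases le_or_gt (gapK (q ω) k) u with hle | hlt
      · exact Or.inl hle
      · have h4 := (hSq ω).sq_le_four_mul_KLfin_of_ne (hq ω).1 (hq ω).2 (hπ ω).1 (hπ ω).2
          (hSπ ω) hω hu.le hlt.le
        refine Or.inr ?_
        simp only [Set.mem_ofPred_eq]
        linarith [hKL ω]
    have hmarkov : μ {ω | u ^ 2 / 8 ≤ KLfin (q ω) (π ω)}
        ≤ ENNReal.ofReal (8 * (∫ ω, KLfin (q ω) (π ω) ∂μ) / u ^ 2) := by
      have h := mul_meas_ge_le_integral_of_nonneg (Filter.Eventually.of_forall hKL) hint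
        (u ^ 2 / 8)
      rw [← ofReal_measureReal]
      refine ENNReal.ofReal_le_ofReal ?_
      rw [le_div_iff₀ (by positivity)]
      linarith
    rw [ENNReal.ofReal_add (by positivity) (by positivity)]
    exact (measure_mono hsub).trans ((measure_union_le _ _).trans
      (add_le_add (hmargin u hu) hmarkov))
  exact ⟨hbound, le_ofReal_mul_rpow_of_forall_le hβ hK hbound⟩
end
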